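/- Let s ≥ 4 be an integer, γ ≥ 1, σ > γ + 1/2 and δ ∈ (0,1). There is a constant C_{s,γ,σ,δ} > 0 such that for every w ∈ H^{s,γ}_{σ,δ}(𝕋×ℝ₊), with u(x,y) = U(x) − ∫_y^∞ w(x,ỹ) dỹ for a given outer flow U ∈ H^s(𝕋), and every multi-index α = (α₁,α₂) with |α| ≤ s−2, one has ‖(1+y)^{γ+α₂} D^α w‖_{L∞(𝕋×ℝ₊)} ≤ C_{s,γ,σ,δ} ‖w‖_{H^{s,γ}_g}. -/

import Mathlib

open MeasureTheory Real Set Filter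

noncomputable section

/-- The domain Ω = 𝕋 × ℝ₊, realized as (0,1) × (0,∞) with x understood with period 1. -/
def OmegaSet : Set (ℝ × ℝ) := Ioo (0:ℝ) 1 ×ˢ Ioi (0:ℝ)

/-- Partial derivative in x. -/
def pdx (f : ℝ × ℝ → ℝ) : ℝ × ℝ → ℝ := fun p => deriv (fun x => f (x, p.2)) p.1

/-- Partial derivative in y. -/
def pdy (f : ℝ × ℝ → ℝ) : ℝ × ℝ → ℝ := fun p => deriv (fun y => f (p.1, y)) p.2

/-- Mixed derivative `D^α = ∂_x^{α₁} ∂_y^{α₂}`. -/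
def Dxy (a b : ℕ) (f : ℝ × ℝ → ℝ) : ℝ × ℝ → ℝ := pdx^[a] (pdy^[b] f)

/-- Weighted L² norm `‖(1+y)^λ f‖_{L²(Ω)}`. -/
def wnorm (lam : ℝ) (f : ℝ × ℝ → ℝ) : ℝ :=
  Real.sqrt (∫ p in OmegaSet, ((1 + p.2) ^ lam * f p) ^ 2)

/-- Sup (L∞) norm over Ω. -/
def OmSup (f : ℝ × ℝ → ℝ) : ℝ := ⨆ p ∈ OmegaSet, |f p|

/-- L²(𝕋) norm. -/
def tnorm (f : ℝ → ℝ) : ℝ := Real.sqrt (∫ x in Ioo (0:ℝ) 1, (f x) ^ 2)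

/-- L∞(𝕋) norm. -/
def tsup (f : ℝ → ℝ) : ℝ := ⨆ x ∈ Ioo (0:ℝ) 1, |f x|

/-- H^m(𝕋) norm. -/
def Hper (m : ℕ) (f : ℝ → ℝ) : ℝ :=
  Real.sqrt (∑ j ∈ Finset.range (m+1), ∫ x in Ioo (0:ℝ) 1, (iteratedDeriv j f x) ^ 2)

/-- Multi-indices α = (α₁, α₂) with |α| ≤ s. -/
def idxFull (s : ℕ) : Finset (ℕ × ℕ) :=
  (Finset.range (s+1) ×ˢ Finset.range (s+1)).filter (fun a => a.1 + a.2 ≤ s)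

/-- Multi-indices with |α| ≤ s and α₁ ≤ s − 1. -/
def idxLow (s : ℕ) : Finset (ℕ × ℕ) :=
  (idxFull s).filter (fun a => a.1 ≤ s - 1)

/-- Squared weighted Sobolev norm `‖w‖²_{H^{s,γ}}`. -/
def HnormSq (s : ℕ) (γ : ℝ) (w : ℝ × ℝ → ℝ) : ℝ :=
  ∑ a ∈ idxFull s, (wnorm (γ + a.2) (Dxy a.1 a.2 w)) ^ 2

/-- `g_k = ∂_x^k w − (∂_y w / w) ∂_x^k (u − U)`. -/
def gfun (w u : ℝ × ℝ → ℝ) (U : ℝ → ℝ) (k : ℕ) : ℝ × ℝ → ℝ :=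
  fun p => Dxy k 0 w p - (pdy w p / w p) * Dxy k 0 (fun q => u q - U q.1) p

/-- Squared norm `‖w‖²_{H^{s,γ}_g}`. -/
def GnormSq (s : ℕ) (γ : ℝ) (w u : ℝ × ℝ → ℝ) (U : ℝ → ℝ) : ℝ :=
  (wnorm γ (gfun w u U s)) ^ 2
    + ∑ a ∈ idxLow s, (wnorm (γ + a.2) (Dxy a.1 a.2 w)) ^ 2

/-- Membership `w ∈ H^{s,γ}_{σ,δ}`: finite `H^{s,γ}` norm, the pointwise lower bound
`(1+y)^σ w ≥ δ`, and the pointwise bound `Σ_{|α|≤2} |(1+y)^{σ+α₂} D^α w|² ≤ δ^{-2}`. -/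
def MemH (s : ℕ) (γ σ δ : ℝ) (w : ℝ × ℝ → ℝ) : Prop :=
  (∀ a ∈ idxFull s,
      IntegrableOn (fun p => ((1 + p.2) ^ (γ + a.2) * Dxy a.1 a.2 w p) ^ 2) OmegaSet) ∧
  (∀ p ∈ OmegaSet, δ ≤ (1 + p.2) ^ σ * w p) ∧
  (∀ p ∈ OmegaSet,
      ∑ a ∈ idxFull 2, ((1 + p.2) ^ (σ + a.2) * Dxy a.1 a.2 w p) ^ 2 ≤ (δ ^ 2)⁻¹)

/-- `u(x,y) = U(x) − ∫_y^∞ w(x,ỹ) dỹ`. -/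
def uOf (U : ℝ → ℝ) (w : ℝ × ℝ → ℝ) : ℝ × ℝ → ℝ :=
  fun p => U p.1 - ∫ t in Ioi p.2, w (p.1, t)

/-- `v(x,y) = − ∫_0^y ∂_x u(x,ỹ) dỹ`. -/
def vOf (u : ℝ × ℝ → ℝ) : ℝ × ℝ → ℝ :=
  fun p => -∫ t in (0:ℝ)..p.2, pdx u (p.1, t)

/-- Classical solution of the ε-regularized Prandtl–Hartmann system on (0,T) × 𝕋 × ℝ₊:
the momentum equation, the divergence-free condition, no-slip boundary conditions,
the far-field condition `u → U`, and the regularized Bernoulli law, together with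
smoothness and x-periodicity of all data. -/
def IsRegSol (ε T : ℝ) (u v : ℝ → ℝ × ℝ → ℝ) (U P : ℝ → ℝ → ℝ) : Prop :=
  ContDiff ℝ (⊤ : ℕ∞) (fun q : ℝ × (ℝ × ℝ) => u q.1 q.2) ∧
  ContDiff ℝ (⊤ : ℕ∞) (fun q : ℝ × (ℝ × ℝ) => v q.1 q.2) ∧
  ContDiff ℝ (⊤ : ℕ∞) (fun q : ℝ × ℝ => U q.1 q.2) ∧
  ContDiff ℝ (⊤ : ℕ∞) (fun q : ℝ × ℝ => P q.1 q.2) ∧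
  (∀ t x y, u t (x + 1, y) = u t (x, y) ∧ v t (x + 1, y) = v t (x, y)) ∧
  (∀ t x, U t (x + 1) = U t x ∧ P t (x + 1) = P t x) ∧
  (∀ t ∈ Ioo (0:ℝ) T, ∀ x : ℝ, ∀ y ∈ Ici (0:ℝ),
      deriv (fun r => u r (x, y)) t + u t (x, y) * pdx (u t) (x, y)
          + v t (x, y) * pdy (u t) (x, y)
        = (U t x - u t (x, y)) + ε ^ 2 * Dxy 2 0 (u t) (x, y)
          + Dxy 0 2 (u t) (x, y) - deriv (P t) x) ∧
  (∀ t ∈ Ioo (0:ℝ) T, ∀ x : ℝ, ∀ y ∈ Ici (0:ℝ),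
      pdx (u t) (x, y) + pdy (v t) (x, y) = 0) ∧
  (∀ t ∈ Ioo (0:ℝ) T, ∀ x : ℝ, u t (x, 0) = 0 ∧ v t (x, 0) = 0) ∧
  (∀ t ∈ Ioo (0:ℝ) T, ∀ x : ℝ,
      Tendsto (fun y => u t (x, y)) atTop (nhds (U t x))) ∧
  (∀ t ∈ Ioo (0:ℝ) T, ∀ x : ℝ,
      deriv (fun r => U r x) t + U t x * deriv (U t) x
        - ε ^ 2 * deriv (deriv (U t)) x + deriv (P t) x = 0)

lemma pdx_eq {f : ℝ × ℝ → ℝ} (hf : ContDiff ℝ (⊤ : ℕ∞) f) :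
    pdx f = fun p => fderiv ℝ f p (1, 0) := by
  funext p
  have h1 : HasFDerivAt f (fderiv ℝ f p) ((fun x : ℝ => (x, p.2)) p.1) :=
    (hf.differentiable (by simp) p).hasFDerivAt
  have h2 : HasDerivAt (fun x : ℝ => (x, p.2)) ((1 : ℝ), (0 : ℝ)) p.1 :=
    (hasDerivAt_id p.1).prodMk (hasDerivAt_const p.1 p.2)
  exact (h1.comp_hasDerivAt p.1 h2).deriv

lemma pdy_eq {f : ℝ × ℝ → ℝ} (hf : ContDiff ℝ (⊤ : ℕ∞) f) :
    pdy f = fun p => fderiv ℝ f p (0, 1) := by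
  funext p
  have h1 : HasFDerivAt f (fderiv ℝ f p) ((fun y : ℝ => (p.1, y)) p.2) :=
    (hf.differentiable (by simp) p).hasFDerivAt
  have h2 : HasDerivAt (fun y : ℝ => (p.1, y)) ((0 : ℝ), (1 : ℝ)) p.2 :=
    (hasDerivAt_const p.2 p.1).prodMk (hasDerivAt_id p.2)
  exact (h1.comp_hasDerivAt p.2 h2).deriv

lemma fderiv_apply_smooth {f : ℝ × ℝ → ℝ} (hf : ContDiff ℝ (⊤ : ℕ∞) f) (v : ℝ × ℝ) :
    ContDiff ℝ (⊤ : ℕ∞) (fun p => fderiv ℝ f p v) :=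
  (hf.fderiv_right (m := ((⊤ : ℕ∞) : WithTop ℕ∞)) (by simp)).clm_apply contDiff_const

lemma pdx_smooth {f : ℝ × ℝ → ℝ} (hf : ContDiff ℝ (⊤ : ℕ∞) f) :
    ContDiff ℝ (⊤ : ℕ∞) (pdx f) := by
  rw [pdx_eq hf]; exact fderiv_apply_smooth hf _

lemma pdy_smooth {f : ℝ × ℝ → ℝ} (hf : ContDiff ℝ (⊤ : ℕ∞) f) :
    ContDiff ℝ (⊤ : ℕ∞) (pdy f) := by
  rw [pdy_eq hf]; exact fderiv_apply_smooth hf _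

lemma pd_comm {f : ℝ × ℝ → ℝ} (hf : ContDiff ℝ (⊤ : ℕ∞) f) :
    pdy (pdx f) = pdx (pdy f) := by
  rw [pdy_eq (pdx_smooth hf), pdx_eq (pdy_smooth hf), pdx_eq hf, pdy_eq hf]
  funext p
  have hd : DifferentiableAt ℝ (fderiv ℝ f) p :=
    (hf.fderiv_right (m := ((⊤ : ℕ∞) : WithTop ℕ∞)) (by simp)).differentiable (by simp) p
  have key : ∀ v u : ℝ × ℝ, fderiv ℝ (fun q => fderiv ℝ f q v) p u
      = fderiv ℝ (fderiv ℝ f) p u v := by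
    intro v u
    rw [fderiv_clm_apply hd (differentiableAt_const v)]
    simp
  rw [key, key]
  have hs : IsSymmSndFDerivAt ℝ f p :=
    (hf.contDiffAt).isSymmSndFDerivAt (by simp; exact WithTop.coe_le_coe.2 (le_top : (2 : ℕ∞) ≤ ⊤))
  exact hs.eq _ _

lemma pdx_iter_smooth {f : ℝ × ℝ → ℝ} (hf : ContDiff ℝ (⊤ : ℕ∞) f) (a : ℕ) :
    ContDiff ℝ (⊤ : ℕ∞) (pdx^[a] f) := by
  induction a with
  | zero => exact hf
  | succ k ih => rw [Function.iterate_succ_apply']; exact pdx_smooth ih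

lemma pdy_iter_smooth {f : ℝ × ℝ → ℝ} (hf : ContDiff ℝ (⊤ : ℕ∞) f) (a : ℕ) :
    ContDiff ℝ (⊤ : ℕ∞) (pdy^[a] f) := by
  induction a with
  | zero => exact hf
  | succ k ih => rw [Function.iterate_succ_apply']; exact pdy_smooth ih

lemma Dxy_smooth {f : ℝ × ℝ → ℝ} (hf : ContDiff ℝ (⊤ : ℕ∞) f) (a b : ℕ) :
    ContDiff ℝ (⊤ : ℕ∞) (Dxy a b f) := pdx_iter_smooth (pdy_iter_smooth hf b) a

lemma pdx_Dxy (f : ℝ × ℝ → ℝ) (a b : ℕ) : pdx (Dxy a b f) = Dxy (a+1) b f := by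
  unfold Dxy; rw [Function.iterate_succ_apply']

lemma pdy_pdx_iter {f : ℝ × ℝ → ℝ} (hf : ContDiff ℝ (⊤ : ℕ∞) f) (a : ℕ) :
    pdy (pdx^[a] f) = pdx^[a] (pdy f) := by
  induction a with
  | zero => rfl
  | succ k ih =>
    rw [Function.iterate_succ_apply', Function.iterate_succ_apply',
      pd_comm (pdx_iter_smooth hf k), ih]

lemma pdy_Dxy {f : ℝ × ℝ → ℝ} (hf : ContDiff ℝ (⊤ : ℕ∞) f) (a b : ℕ) :
    pdy (Dxy a b f) = Dxy a (b+1) f := by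
  unfold Dxy
  rw [pdy_pdx_iter (pdy_iter_smooth hf b), Function.iterate_succ_apply']

lemma sob1 (h h' : ℝ → ℝ) (hd : ∀ t, HasDerivAt h (h' t) t) (hc : Continuous h')
    (a t : ℝ) (ht : t ∈ Icc a (a+1)) :
    h t ^ 2 ≤ ∫ r in a..(a+1), (2 * h r ^ 2 + h' r ^ 2) := by
  have hh : Continuous h := continuous_iff_continuousAt.2 fun t => (hd t).continuousAt
  have hle : a ≤ a + 1 := by linarith
  set K := ∫ r in a..(a+1), (h r ^ 2 + h' r ^ 2) with hK
  have h1 : ∀ r ∈ Icc a (a+1), h t ^ 2 ≤ h r ^ 2 + K := by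
    intro r hr
    have e : ∫ q in r..t, (2 * h q * h' q) = h t ^ 2 - h r ^ 2 := by
      refine intervalIntegral.integral_eq_sub_of_hasDerivAt (f := fun q => h q ^ 2) ?_ ?_
      · intro q _
        have := (hd q).pow 2
        simp only [Nat.cast_ofNat, Nat.add_one_sub_one, pow_one] at this
        exact this
      · exact Continuous.intervalIntegrable (by fun_prop) _ _
    have b1 : |∫ q in r..t, (2 * h q * h' q)| ≤ abs (∫ q in r..t, abs (2 * h q * h' q)) := by
      simpa using intervalIntegral.norm_integral_le_abs_integral_norm
        (f := fun q => 2 * h q * h' q) (a := r) (b := t) (μ := volume)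
    have b2 : abs (∫ q in r..t, abs (2 * h q * h' q)) ≤ abs (∫ q in a..(a+1), abs (2 * h q * h' q)) := by
      refine intervalIntegral.abs_integral_mono_interval ?_ ?_ ?_
      · rw [uIoc_of_le hle]
        intro q hq
        rcases mem_uIoc.1 hq with ⟨h1, h2⟩ | ⟨h1, h2⟩
        · exact ⟨by linarith [hr.1], by linarith [ht.2]⟩
        · exact ⟨by linarith [ht.1], by linarith [hr.2]⟩
      · exact Filter.Eventually.of_forall fun q => abs_nonneg _
      · exact Continuous.intervalIntegrable (by fun_prop) _ _
    have b3 : abs (∫ q in a..(a+1), abs (2 * h q * h' q)) ≤ K := by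
      rw [abs_of_nonneg (intervalIntegral.integral_nonneg hle fun q _ => abs_nonneg _)]
      refine intervalIntegral.integral_mono_on hle
        (Continuous.intervalIntegrable (by fun_prop) _ _)
        (Continuous.intervalIntegrable (by fun_prop) _ _) ?_
      intro q _
      rw [abs_le]
      constructor <;> nlinarith [sq_nonneg (h q - h' q), sq_nonneg (h q + h' q)]
    have := le_abs_self (∫ q in r..t, (2 * h q * h' q))
    linarith
  have h2 : ∫ r in a..(a+1), h t ^ 2 ≤ ∫ r in a..(a+1), (h r ^ 2 + K) :=
    intervalIntegral.integral_mono_on hle (by simp)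
      (Continuous.intervalIntegrable (by fun_prop) _ _) h1
  rw [intervalIntegral.integral_add (Continuous.intervalIntegrable (by fun_prop) _ _) (by simp)]
    at h2
  simp only [intervalIntegral.integral_const, add_sub_cancel_left, one_smul] at h2
  have h3 : ∫ r in a..(a+1), (2 * h r ^ 2 + h' r ^ 2) = (∫ r in a..(a+1), h r ^ 2) + K := by
    rw [hK, ← intervalIntegral.integral_add (Continuous.intervalIntegrable (by fun_prop) _ _)
      (Continuous.intervalIntegrable (by fun_prop) _ _)]
    congr 1; funext r; ring
  rw [h3]; exact h2

lemma hasDeriv_x {f : ℝ × ℝ → ℝ} (hf : ContDiff ℝ (⊤ : ℕ∞) f) (y x : ℝ) :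
    HasDerivAt (fun x => f (x, y)) (pdx f (x, y)) x := by
  have : ContDiff ℝ (⊤ : ℕ∞) (fun x => f (x, y)) := by fun_prop
  exact (this.differentiable (by simp) x).hasDerivAt

lemma hasDeriv_y {f : ℝ × ℝ → ℝ} (hf : ContDiff ℝ (⊤ : ℕ∞) f) (x y : ℝ) :
    HasDerivAt (fun y => f (x, y)) (pdy f (x, y)) y := by
  have : ContDiff ℝ (⊤ : ℕ∞) (fun y => f (x, y)) := by fun_prop
  exact (this.differentiable (by simp) y).hasDerivAt

lemma sob2 {f : ℝ × ℝ → ℝ} (hf : ContDiff ℝ (⊤ : ℕ∞) f) (x y : ℝ) (hx : x ∈ Icc (0:ℝ) 1) :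
    f (x, y) ^ 2 ≤ ∫ p in Ioo (0:ℝ) 1 ×ˢ Ioc y (y+1),
      (4 * f p ^ 2 + 2 * pdy f p ^ 2 + 2 * pdx f p ^ 2 + pdy (pdx f) p ^ 2) := by
  have c0 := hf.continuous
  have c1 := (pdx_smooth hf).continuous
  have c2 := (pdy_smooth hf).continuous
  have c3 := (pdy_smooth (pdx_smooth hf)).continuous
  set G : ℝ × ℝ → ℝ := fun p =>
    4 * f p ^ 2 + 2 * pdy f p ^ 2 + 2 * pdx f p ^ 2 + pdy (pdx f) p ^ 2 with hG
  have cG : Continuous G := by fun_prop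
  have s1 := sob1 (fun x => f (x, y)) (fun x => pdx f (x, y)) (hasDeriv_x hf y)
    (by fun_prop) 0 x (by simpa using hx)
  simp only [zero_add] at s1
  have s2 : ∀ r ∈ Icc (0:ℝ) 1, 2 * f (r, y) ^ 2 + pdx f (r, y) ^ 2
      ≤ ∫ q in y..(y+1), G (r, q) := by
    intro r _
    have t1 := sob1 (fun y => f (r, y)) (fun y => pdy f (r, y)) (hasDeriv_y hf r)
      (by fun_prop) y y ⟨le_rfl, by linarith⟩
    have t2 := sob1 (fun y => pdx f (r, y)) (fun y => pdy (pdx f) (r, y))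
      (hasDeriv_y (pdx_smooth hf) r) (by fun_prop) y y ⟨le_rfl, by linarith⟩
    have e : ∫ q in y..(y+1), G (r, q) =
        2 * (∫ q in y..(y+1), (2 * f (r, q) ^ 2 + pdy f (r, q) ^ 2))
        + ∫ q in y..(y+1), (2 * pdx f (r, q) ^ 2 + pdy (pdx f) (r, q) ^ 2) := by
      rw [← intervalIntegral.integral_const_mul, ← intervalIntegral.integral_add
        (Continuous.intervalIntegrable (by fun_prop) _ _)
        (Continuous.intervalIntegrable (by fun_prop) _ _)]
      congr 1; funext q; simp only [hG]; ring
    rw [e]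
    linarith
  have s3 : ∫ r in (0:ℝ)..1, (2 * f (r, y) ^ 2 + pdx f (r, y) ^ 2)
      ≤ ∫ r in (0:ℝ)..1, ∫ q in y..(y+1), G (r, q) := by
    refine intervalIntegral.integral_mono_on zero_le_one
      (Continuous.intervalIntegrable (by fun_prop) _ _)
      (Continuous.intervalIntegrable ?_ _ _) s2
    exact intervalIntegral.continuous_parametric_intervalIntegral_of_continuous'
      (f := fun r q => G (r, q)) cG _ _
  have s4 : ∫ r in (0:ℝ)..1, ∫ q in y..(y+1), G (r, q)
      = ∫ p in Ioo (0:ℝ) 1 ×ˢ Ioc y (y+1), G p := by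
    rw [Measure.volume_eq_prod, setIntegral_prod, intervalIntegral.integral_of_le zero_le_one,
      integral_Ioc_eq_integral_Ioo]
    · simp_rw [intervalIntegral.integral_of_le (show y ≤ y + 1 by linarith)]
    · rw [← Measure.volume_eq_prod]
      exact (cG.continuousOn.integrableOn_compact (isCompact_Icc.prod isCompact_Icc)).mono_set
        (prod_mono Ioo_subset_Icc_self Ioc_subset_Icc_self)
  rw [← s4]
  exact s1.trans s3

lemma wnorm_sq (l : ℝ) (f : ℝ × ℝ → ℝ) :
    wnorm l f ^ 2 = ∫ p in OmegaSet, ((1 + p.2) ^ l * f p) ^ 2 :=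
  Real.sq_sqrt (integral_nonneg fun _ => sq_nonneg _)

lemma wmono {y q l m v : ℝ} (hy : 0 < y) (hq : y ≤ q) (hl : 0 ≤ l) (hm : l ≤ m) :
    ((1 + y) ^ l) ^ 2 * v ^ 2 ≤ ((1 + q) ^ m * v) ^ 2 := by
  rw [mul_pow]
  have h1 : (1 + y) ^ l ≤ (1 + q) ^ m :=
    (Real.rpow_le_rpow (by linarith) (by linarith) hl).trans
      (Real.rpow_le_rpow_of_exponent_le (by linarith) hm)
  have h0 : 0 ≤ (1 + y) ^ l := Real.rpow_nonneg (by linarith) _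
  gcongr

lemma sob3 {f : ℝ × ℝ → ℝ} (hf : ContDiff ℝ (⊤ : ℕ∞) f) (l : ℝ) (hl : 0 ≤ l)
    (i0 : IntegrableOn (fun p => ((1 + p.2) ^ l * f p) ^ 2) OmegaSet)
    (i1 : IntegrableOn (fun p => ((1 + p.2) ^ (l+1) * pdy f p) ^ 2) OmegaSet)
    (i2 : IntegrableOn (fun p => ((1 + p.2) ^ l * pdx f p) ^ 2) OmegaSet)
    (i3 : IntegrableOn (fun p => ((1 + p.2) ^ (l+1) * pdy (pdx f) p) ^ 2) OmegaSet)
    (p : ℝ × ℝ) (hp : p ∈ OmegaSet) :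
    ((1 + p.2) ^ l * f p) ^ 2 ≤ 4 * wnorm l f ^ 2 + 2 * wnorm (l+1) (pdy f) ^ 2
      + 2 * wnorm l (pdx f) ^ 2 + wnorm (l+1) (pdy (pdx f)) ^ 2 := by
  obtain ⟨x, y⟩ := p
  obtain ⟨hx, hy⟩ := hp
  simp only [mem_Ioi] at hx hy
  have c0 := hf.continuous
  have c1 := (pdx_smooth hf).continuous
  have c2 := (pdy_smooth hf).continuous
  have c3 := (pdy_smooth (pdx_smooth hf)).continuous
  have hb := sob2 hf x y ⟨hx.1.le, hx.2.le⟩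
  have hsub : Ioo (0:ℝ) 1 ×ˢ Ioc y (y+1) ⊆ OmegaSet :=
    prod_mono subset_rfl fun q hq => lt_trans hy hq.1
  have j0 := i0.const_mul 4
  have j1 := i1.const_mul 2
  have j2 := i2.const_mul 2
  have J := ((j0.add j1).add j2).add i3
  have e : ∫ p in OmegaSet, (4 * ((1 + p.2) ^ l * f p) ^ 2 + 2 * ((1 + p.2) ^ (l+1) * pdy f p) ^ 2
      + 2 * ((1 + p.2) ^ l * pdx f p) ^ 2 + ((1 + p.2) ^ (l+1) * pdy (pdx f) p) ^ 2) =
      4 * wnorm l f ^ 2 + 2 * wnorm (l+1) (pdy f) ^ 2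
      + 2 * wnorm l (pdx f) ^ 2 + wnorm (l+1) (pdy (pdx f)) ^ 2 := by
    simp only [wnorm_sq, ← integral_const_mul]
    rw [← integral_add j0 j1]
    erw [← integral_add (j0.add j1) j2, ← integral_add ((j0.add j1).add j2) i3]
    rfl
  rw [← e, mul_pow]
  calc ((1 + y) ^ l) ^ 2 * f (x, y) ^ 2
      ≤ ((1 + y) ^ l) ^ 2 * ∫ p in Ioo (0:ℝ) 1 ×ˢ Ioc y (y+1),
        (4 * f p ^ 2 + 2 * pdy f p ^ 2 + 2 * pdx f p ^ 2 + pdy (pdx f) p ^ 2) := by gcongr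
    _ = ∫ p in Ioo (0:ℝ) 1 ×ˢ Ioc y (y+1), ((1 + y) ^ l) ^ 2 *
        (4 * f p ^ 2 + 2 * pdy f p ^ 2 + 2 * pdx f p ^ 2 + pdy (pdx f) p ^ 2) := by
        rw [integral_const_mul]
    _ ≤ ∫ p in Ioo (0:ℝ) 1 ×ˢ Ioc y (y+1),
        (4 * ((1 + p.2) ^ l * f p) ^ 2 + 2 * ((1 + p.2) ^ (l+1) * pdy f p) ^ 2
      + 2 * ((1 + p.2) ^ l * pdx f p) ^ 2 + ((1 + p.2) ^ (l+1) * pdy (pdx f) p) ^ 2) := by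
        refine setIntegral_mono_on ?_ (IntegrableOn.mono_set J hsub)
          (measurableSet_Ioo.prod measurableSet_Ioc) ?_
        · have : Continuous fun p : ℝ × ℝ => ((1 + y) ^ l) ^ 2 *
            (4 * f p ^ 2 + 2 * pdy f p ^ 2 + 2 * pdx f p ^ 2 + pdy (pdx f) p ^ 2) := by fun_prop
          exact (this.continuousOn.integrableOn_compact (isCompact_Icc.prod isCompact_Icc)).mono_set
            (prod_mono Ioo_subset_Icc_self Ioc_subset_Icc_self)
        · rintro ⟨r, q⟩ ⟨_, hq⟩
          have hq' : y ≤ q := hq.1.le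
          have k0 := wmono (v := f (r, q)) hy hq' hl le_rfl
          have k1 := wmono (v := pdy f (r, q)) hy hq' hl (show l ≤ l + 1 by linarith)
          have k2 := wmono (v := pdx f (r, q)) hy hq' hl le_rfl
          have k3 := wmono (v := pdy (pdx f) (r, q)) hy hq' hl (show l ≤ l + 1 by linarith)
          simp only
          linarith
    _ ≤ _ := by
        refine setIntegral_mono_set J ?_ hsub.eventuallyLE
        exact Filter.Eventually.of_forall fun p => by
          simp only [Pi.zero_apply]; positivity

/-- L∞ bound on `(1+y)^{γ+α₂} D^α w` for `|α| ≤ s−2`. -/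
theorem stmt10 (s : ℕ) (hs : 4 ≤ s) (γ σ δ : ℝ) (hγ : 1 ≤ γ)
    (hσ : γ + 1/2 < σ) (hδ : δ ∈ Ioo (0:ℝ) 1) :
    ∃ C > (0:ℝ),
      ∀ (w : ℝ × ℝ → ℝ) (U : ℝ → ℝ),
        ContDiff ℝ (⊤ : ℕ∞) w → (∀ x y : ℝ, w (x + 1, y) = w (x, y)) →
        ContDiff ℝ (⊤ : ℕ∞) U → Function.Periodic U 1 →
        MemH s γ σ δ w →
        ∀ a b : ℕ, a + b ≤ s - 2 →
          OmSup (fun p => (1 + p.2) ^ (γ + b) * Dxy a b w p)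
            ≤ C * Real.sqrt (GnormSq s γ w (uOf U w) U) := by
  refine ⟨3, by norm_num, ?_⟩
  intro w U hw _ _ _ hm a b hab
  have hbd : ∀ p ∈ OmegaSet, |(1 + p.2) ^ (γ + b) * Dxy a b w p|
      ≤ 3 * Real.sqrt (GnormSq s γ w (uOf U w) U) := by
    intro p hp
    have hI : ∀ i j : ℕ, i + j ≤ s → IntegrableOn
        (fun p => ((1 + p.2) ^ (γ + j) * Dxy i j w p) ^ 2) OmegaSet := fun i j hij =>
      hm.1 (i, j) (by simp [idxFull]; omega)
    have hN : ∀ i j : ℕ, i + j ≤ s → i ≤ s - 1 →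
        wnorm (γ + j) (Dxy i j w) ^ 2 ≤ GnormSq s γ w (uOf U w) U := by
      intro i j hij hi
      have h1 := Finset.single_le_sum (s := idxLow s)
        (f := fun a : ℕ × ℕ => (wnorm (γ + a.2) (Dxy a.1 a.2 w)) ^ 2)
        (fun _ _ => sq_nonneg _) (show (i, j) ∈ idxLow s by simp [idxLow, idxFull]; omega)
      have h2 := sq_nonneg (wnorm γ (gfun w (uOf U w) U s))
      unfold GnormSq
      simp only at h1
      linarith
    have hl : 0 ≤ γ + (b:ℝ) := by positivity
    have hc : γ + (b:ℝ) + 1 = γ + ((b + 1 : ℕ) : ℝ) := by push_cast; ring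
    have key := sob3 (Dxy_smooth hw a b) (γ + b) hl
    rw [pdx_Dxy, pdy_Dxy hw, pdy_Dxy hw, hc] at key
    have K := key (hI a b (by omega)) (hI a (b+1) (by omega)) (hI (a+1) b (by omega))
      (hI (a+1) (b+1) (by omega)) p hp
    have n0 := hN a b (by omega) (by omega)
    have n1 := hN a (b+1) (by omega) (by omega)
    have n2 := hN (a+1) b (by omega) (by omega)
    have n3 := hN (a+1) (b+1) (by omega) (by omega)
    have hG : 0 ≤ GnormSq s γ w (uOf U w) U := (sq_nonneg _).trans n0
    apply abs_le_of_sq_le_sq _ (by positivity)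
    rw [mul_pow 3, Real.sq_sqrt hG]
    linarith
  have h0 : 0 ≤ 3 * Real.sqrt (GnormSq s γ w (uOf U w) U) := by positivity
  exact Real.iSup_le (fun p => Real.iSup_le (fun hp => hbd p hp) h0) h0
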